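/- Conservation of Kelvin's circulation for deep learning (Lemma 6.1, parametrized form): Let n ≥ 1. Let w : ℝⁿ × ℝ → ℝⁿ be a smooth vector field and Φ : ℝⁿ × ℝ → ℝⁿ a smooth map with Φ(x,0) = x and ∂_t Φ(x,t) = w(Φ(x,t), t) for all (x,t) (the flow of w). Let ρ, h : ℝⁿ × ℝ → ℝ and m : ℝⁿ × ℝ → ℝⁿ be smooth with ρ > 0 everywhere, satisfying the continuity equation ∂_t ρ + Σ_j ∂_j(ρ w^j) = 0 and the Euler–Poincaré equation ∂_t m_i + Σ_j ∂_j(m_i w^j) + Σ_j m_j ∂_i w^j = ρ ∂_i h for every i. Let γ : [0,1] → ℝⁿ be a smooth closed curve, γ(0) = γ(1). Then the circulation I(t) := ∫₀¹ Σ_i (m_i/ρ)(Φ(γ(s), t), t) · ∂_s Φ^i(γ(s), t) ds is constant in t. -/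

import Mathlib

open Real MeasureTheory

/-- Partial derivative in the time variable of `u : ℝⁿ × ℝ → ℝ`. -/
noncomputable def pderivT (n : ℕ) (u : (Fin n → ℝ) × ℝ → ℝ) (p : (Fin n → ℝ) × ℝ) : ℝ :=
  deriv (fun s => u (p.1, s)) p.2

/-- Partial derivative in the `i`-th spatial coordinate of `u : ℝⁿ × ℝ → ℝ`. -/
noncomputable def pderivX (n : ℕ) (i : Fin n) (u : (Fin n → ℝ) × ℝ → ℝ)
    (p : (Fin n → ℝ) × ℝ) : ℝ :=
  deriv (fun s => u (Function.update p.1 i s, p.2)) (p.1 i)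

theorem pderivT_eq_fderiv {n : ℕ} {u : (Fin n → ℝ) × ℝ → ℝ} {p : (Fin n → ℝ) × ℝ}
    (hu : DifferentiableAt ℝ u p) : pderivT n u p = fderiv ℝ u p (0, 1) :=
  (hu.hasFDerivAt.comp_hasDerivAt p.2
    ((hasDerivAt_const p.2 p.1).prodMk (hasDerivAt_id p.2))).deriv

theorem pderivX_eq_fderiv {n : ℕ} {u : (Fin n → ℝ) × ℝ → ℝ} {p : (Fin n → ℝ) × ℝ}
    (hu : DifferentiableAt ℝ u p) (i : Fin n) :
    pderivX n i u p = fderiv ℝ u p (Pi.single i 1, 0) := by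
  have hu' : HasFDerivAt u (fderiv ℝ u p) (Function.update p.1 i (p.1 i), p.2) := by
    simpa using hu.hasFDerivAt
  exact (hu'.comp_hasDerivAt (p.1 i)
    ((hasDerivAt_update p.1 i (p.1 i)).prodMk (hasDerivAt_const (p.1 i) p.2))).deriv

theorem pderivX_mul {n : ℕ} {u v : (Fin n → ℝ) × ℝ → ℝ} {p : (Fin n → ℝ) × ℝ}
    (hu : DifferentiableAt ℝ u p) (hv : DifferentiableAt ℝ v p) (i : Fin n) :
    pderivX n i (fun q => u q * v q) p = pderivX n i u p * v p + u p * pderivX n i v p := by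
  rw [pderivX_eq_fderiv (hu.fun_mul hv), pderivX_eq_fderiv hu, pderivX_eq_fderiv hv,
    fderiv_fun_mul hu hv]
  simp
  ring

theorem fderiv_eq_sum_pderiv {n : ℕ} {u : (Fin n → ℝ) × ℝ → ℝ} {p : (Fin n → ℝ) × ℝ}
    (hu : DifferentiableAt ℝ u p) (v : Fin n → ℝ) (τ : ℝ) :
    fderiv ℝ u p (v, τ) = (∑ j, v j * pderivX n j u p) + τ * pderivT n u p := by
  have hv : ((v, τ) : (Fin n → ℝ) × ℝ)
      = (∑ j, v j • ((Pi.single j 1, 0) : (Fin n → ℝ) × ℝ)) + τ • (0, 1) := by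
    ext k
    · simp [Prod.fst_sum, Finset.sum_apply, Pi.single_apply]
    · simp [Prod.snd_sum]
  rw [hv]
  simp only [map_add, map_sum, map_smul, smul_eq_mul, pderivX_eq_fderiv hu, pderivT_eq_fderiv hu]

/-- Chain rule along a curve in space-time. -/
theorem hasDerivAt_comp_pderiv {n : ℕ} {u : (Fin n → ℝ) × ℝ → ℝ} {c : ℝ → (Fin n → ℝ) × ℝ}
    {v : Fin n → ℝ} {τ r : ℝ} (hu : DifferentiableAt ℝ u (c r)) (hc : HasDerivAt c (v, τ) r) :
    HasDerivAt (fun s => u (c s))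
      ((∑ j, v j * pderivX n j u (c r)) + τ * pderivT n u (c r)) r := by
  rw [← fderiv_eq_sum_pderiv hu]
  exact hu.hasFDerivAt.comp_hasDerivAt r hc

theorem hasDerivAt_slice_fst {F : Type*} [NormedAddCommGroup F] [NormedSpace ℝ F] {g : ℝ × ℝ → F}
    {s t : ℝ} (hg : DifferentiableAt ℝ g (s, t)) :
    HasDerivAt (fun s' => g (s', t)) (fderiv ℝ g (s, t) (1, 0)) s :=
  hg.hasFDerivAt.comp_hasDerivAt s ((hasDerivAt_id s).prodMk (hasDerivAt_const s t))

theorem hasDerivAt_slice_snd {F : Type*} [NormedAddCommGroup F] [NormedSpace ℝ F] {g : ℝ × ℝ → F}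
    {s t : ℝ} (hg : DifferentiableAt ℝ g (s, t)) :
    HasDerivAt (fun t' => g (s, t')) (fderiv ℝ g (s, t) (0, 1)) t :=
  hg.hasFDerivAt.comp_hasDerivAt t ((hasDerivAt_const t s).prodMk (hasDerivAt_id t))

/-- Equality of mixed partial derivatives, as a derivative of the first partial derivative. -/
theorem hasDerivAt_fderiv_fst {g f : ℝ × ℝ → ℝ} (hg : ContDiff ℝ 2 g)
    (hgf : ∀ p, fderiv ℝ g p (0, 1) = f p) (s t : ℝ) :
    HasDerivAt (fun t' => fderiv ℝ g (s, t') (1, 0)) (fderiv ℝ f (s, t) (1, 0)) t := by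
  have hd : Differentiable ℝ (fderiv ℝ g) :=
    (hg.fderiv_right (m := 1) (by norm_num)).differentiable (by norm_num)
  have key (v : ℝ × ℝ) : HasFDerivAt (fun p => fderiv ℝ g p v)
      ((fderiv ℝ (fderiv ℝ g) (s, t)).flip v) (s, t) := by
    simpa using (hd (s, t)).hasFDerivAt.clm_apply (hasFDerivAt_const v (s, t))
  have hsymm : IsSymmSndFDerivAt ℝ g (s, t) := hg.contDiffAt.isSymmSndFDerivAt (by simp)
  have hf : fderiv ℝ f (s, t) = (fderiv ℝ (fderiv ℝ g) (s, t)).flip (0, 1) := by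
    rw [← (key (0, 1)).fderiv]
    exact congrArg (fderiv ℝ · (s, t)) (funext fun p => (hgf p).symm)
  have := hasDerivAt_slice_snd (key (1, 0)).differentiableAt
  rw [(key (1, 0)).fderiv] at this
  rw [hf]
  simpa [ContinuousLinearMap.flip_apply, hsymm.eq (1, 0) (0, 1)] using this

/-- The integral over a period of a density satisfying a conservation law is constant. -/
theorem intervalIntegral_eq_of_conservation_law {G H : ℝ × ℝ → ℝ} (hG : Differentiable ℝ G)
    (hH : Differentiable ℝ H) (hGH : ∀ p, fderiv ℝ G p (0, 1) = fderiv ℝ H p (1, 0)) {a b : ℝ}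
    (hper : ∀ t, H (a, t) = H (b, t)) (t₁ t₂ : ℝ) :
    (∫ s in a..b, G (s, t₁)) = ∫ s in a..b, G (s, t₂) := by
  have hzero : (fun p => fderiv ℝ H p (1, 0) + (-fderiv ℝ G p) (0, 1)) = fun _ => (0 : ℝ) := by
    funext p
    simp [hGH p]
  have key := integral2_divergence_prod_of_hasFDerivAt_off_countable H (fun p => -G p)
    (fderiv ℝ H) (fun p => -fderiv ℝ G p) a t₁ b t₂ ∅ Set.countable_empty
    hH.continuous.continuousOn hG.continuous.neg.continuousOn
    (fun p _ => (hH p).hasFDerivAt) (fun p _ => (hG p).hasFDerivAt.neg)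
    (by rw [hzero]; exact integrableOn_zero)
  have hz (x y : ℝ) : fderiv ℝ H (x, y) (1, 0) + (-fderiv ℝ G (x, y)) (0, 1) = 0 :=
    congrFun hzero (x, y)
  simp only [hz, intervalIntegral.integral_zero, intervalIntegral.integral_neg, hper] at key
  linarith

/-- The pointwise algebra behind Kelvin's theorem: `ṁ` and `ρ'` are material derivatives, `D i j`
is the `j`-th partial derivative of the `i`-th velocity component. -/
theorem circulation_density_identity {ι : Type*} [Fintype ι] {M M' A dh : ι → ℝ} {D : ι → ι → ℝ}
    {R R' : ℝ} (hR : R ≠ 0) (hR' : R' + R * ∑ j, D j j = 0)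
    (hM' : ∀ i, M' i + M i * (∑ j, D j j) + ∑ j, M j * D j i = R * dh i) :
    ∑ i, ((M' i * R - M i * R') / R ^ 2 * A i + M i / R * ∑ j, A j * D i j)
      = ∑ i, A i * dh i := by
  have hterm (i : ι) : (M' i * R - M i * R') / R ^ 2 * A i
      = A i * dh i - ∑ j, M j / R * (A i * D j i) := by
    have hs : ∑ j, M j / R * (A i * D j i) = (∑ j, M j * D j i) * (A i / R) := by
      rw [Finset.sum_mul]
      exact Finset.sum_congr rfl fun j _ => by ring
    rw [hs, show M' i = R * dh i - M i * (∑ j, D j j) - ∑ j, M j * D j i by linarith [hM' i],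
      show R' = -(R * ∑ j, D j j) by linarith]
    field_simp
    ring
  simp only [hterm, Finset.sum_add_distrib, Finset.sum_sub_distrib, Finset.mul_sum]
  rw [Finset.sum_comm]
  ring

/-- Conservation of Kelvin's circulation for deep learning: along the flow `Φ` of the
vector field `w`, with `ρ > 0` satisfying the continuity equation and `m` the
Euler–Poincaré equation with source `ρ∇h`, the circulation
`I(t) = ∮ (m/ρ)·dx` over the advected loop `Φ(γ(·), t)` is constant in `t`. -/
theorem kelvin_circulation_conservation (n : ℕ) (hn : 1 ≤ n)
    (w Φ : (Fin n → ℝ) × ℝ → Fin n → ℝ)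
    (hw : ContDiff ℝ (⊤ : ℕ∞) w) (hΦ : ContDiff ℝ (⊤ : ℕ∞) Φ)
    (hΦ0 : ∀ x, Φ (x, 0) = x)
    (hflow : ∀ x t k, HasDerivAt (fun s => Φ (x, s) k) (w (Φ (x, t), t) k) t)
    (ρ h : (Fin n → ℝ) × ℝ → ℝ) (m : (Fin n → ℝ) × ℝ → Fin n → ℝ)
    (hρ : ContDiff ℝ (⊤ : ℕ∞) ρ) (hh : ContDiff ℝ (⊤ : ℕ∞) h) (hm : ContDiff ℝ (⊤ : ℕ∞) m)
    (hρpos : ∀ p, 0 < ρ p)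
    (hcont : ∀ p, pderivT n ρ p + (∑ j, pderivX n j (fun q => ρ q * w q j) p) = 0)
    (hEP : ∀ p (i : Fin n),
      pderivT n (fun q => m q i) p + (∑ j, pderivX n j (fun q => m q i * w q j) p)
        + (∑ j, m p j * pderivX n i (fun q => w q j) p) = ρ p * pderivX n i h p)
    (γ : ℝ → Fin n → ℝ) (hγ : ContDiff ℝ (⊤ : ℕ∞) γ) (hγclosed : γ 0 = γ 1) :
    ∀ t₁ t₂ : ℝ,
      (∫ s in (0:ℝ)..1, ∑ i, m (Φ (γ s, t₁), t₁) i / ρ (Φ (γ s, t₁), t₁)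
          * deriv (fun s' => Φ (γ s', t₁) i) s)
      = ∫ s in (0:ℝ)..1, ∑ i, m (Φ (γ s, t₂), t₂) i / ρ (Φ (γ s, t₂), t₂)
          * deriv (fun s' => Φ (γ s', t₂) i) s := by
  have hne : ((⊤ : ℕ∞) : WithTop ℕ∞) ≠ 0 := by simp
  have hwi (i : Fin n) : ContDiff ℝ (⊤ : ℕ∞) fun q => w q i := contDiff_pi.1 hw i
  have hmi (i : Fin n) : ContDiff ℝ (⊤ : ℕ∞) fun q => m q i := contDiff_pi.1 hm i
  set Ψ : ℝ × ℝ → (Fin n → ℝ) × ℝ := fun p => (Φ (γ p.1, p.2), p.2) with hΨdef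
  have hψ : ContDiff ℝ (⊤ : ℕ∞) fun p : ℝ × ℝ => Φ (γ p.1, p.2) :=
    hΦ.comp ((hγ.comp contDiff_fst).prodMk contDiff_snd)
  have hψi (i : Fin n) : ContDiff ℝ (⊤ : ℕ∞) fun p : ℝ × ℝ => Φ (γ p.1, p.2) i :=
    contDiff_pi.1 hψ i
  have hΨ : ContDiff ℝ (⊤ : ℕ∞) Ψ := hψ.prodMk contDiff_snd
  set A : Fin n → ℝ × ℝ → ℝ :=
    fun i p => fderiv ℝ (fun p : ℝ × ℝ => Φ (γ p.1, p.2) i) p (1, 0)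
  have hA (i : Fin n) : ContDiff ℝ (⊤ : ℕ∞) (A i) :=
    ((hψi i).fderiv_right (by simp)).clm_apply contDiff_const
  have hψs (s t : ℝ) (i : Fin n) : HasDerivAt (fun s' => Φ (γ s', t) i) (A i (s, t)) s :=
    hasDerivAt_slice_fst ((hψi i).differentiable hne (s, t))
  have hψt (p : ℝ × ℝ) (i : Fin n) :
      fderiv ℝ (fun p : ℝ × ℝ => Φ (γ p.1, p.2) i) p (0, 1) = w (Ψ p) i :=
    (hasDerivAt_slice_snd (s := p.1) (t := p.2) ((hψi i).differentiable hne p)).unique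
      (hflow (γ p.1) p.2 i)
  have hΨs (s t : ℝ) : HasDerivAt (fun s' => Ψ (s', t)) (fun i => A i (s, t), 0) s :=
    (hasDerivAt_pi.2 (hψs s t)).prodMk (hasDerivAt_const s t)
  have hΨt (s t : ℝ) : HasDerivAt (fun t' => Ψ (s, t')) (w (Ψ (s, t)), 1) t :=
    (hasDerivAt_pi.2 (hflow (γ s) t)).prodMk (hasDerivAt_id t)
  have fderiv_comp_s {u : (Fin n → ℝ) × ℝ → ℝ} (hu : ContDiff ℝ (⊤ : ℕ∞) u) (s t : ℝ) :
      fderiv ℝ (fun p => u (Ψ p)) (s, t) (1, 0)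
        = ∑ j, A j (s, t) * pderivX n j u (Ψ (s, t)) := by
    have h₁ := hasDerivAt_slice_fst ((hu.comp hΨ).differentiable hne (s, t))
    have h₂ := hasDerivAt_comp_pderiv (c := fun s' => Ψ (s', t))
      (hu.differentiable hne (Ψ (s, t))) (hΨs s t)
    exact h₁.unique (by simpa using h₂)
  have hAt (s t : ℝ) (i : Fin n) : HasDerivAt (fun t' => A i (s, t'))
      (∑ j, A j (s, t) * pderivX n j (fun q => w q i) (Ψ (s, t))) t := by
    rw [← fderiv_comp_s (hwi i)]
    exact hasDerivAt_fderiv_fst (contDiff_infty.1 (hψi i) 2) (hψt · i) s t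
  set G : ℝ × ℝ → ℝ := fun p => ∑ i, m (Ψ p) i / ρ (Ψ p) * A i p
  have hG : Differentiable ℝ G :=
    (ContDiff.sum fun i _ => (((hmi i).comp hΨ).div (hρ.comp hΨ) fun p => (hρpos _).ne').mul
      (hA i)).differentiable hne
  have hlaw (p : ℝ × ℝ) : fderiv ℝ G p (0, 1) = fderiv ℝ (fun p => h (Ψ p)) p (1, 0) := by
    obtain ⟨s, t⟩ := p
    rw [fderiv_comp_s hh]
    have hmt (i : Fin n) :=
      hasDerivAt_comp_pderiv (c := fun t' => Ψ (s, t'))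
        ((hmi i).differentiable hne (Ψ (s, t))) (hΨt s t)
    have hρt := hasDerivAt_comp_pderiv (c := fun t' => Ψ (s, t'))
      (hρ.differentiable hne (Ψ (s, t))) (hΨt s t)
    have hGt := HasDerivAt.fun_sum (u := Finset.univ) fun i _ =>
      ((hmt i).fun_div hρt (hρpos _).ne').fun_mul (hAt s t i)
    rw [(hasDerivAt_slice_snd (hG (s, t))).unique hGt]
    refine circulation_density_identity (D := fun i j => pderivX n j (fun q => w q i) (Ψ (s, t)))
      (hρpos _).ne' ?_ fun i => ?_
    · rw [← hcont (Ψ (s, t))]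
      simp only [pderivX_mul (hρ.differentiable hne _) ((hwi _).differentiable hne _),
        Finset.sum_add_distrib, Finset.mul_sum, mul_comm (w _ _)]
      ring
    · rw [← hEP (Ψ (s, t)) i]
      simp only [pderivX_mul ((hmi i).differentiable hne _) ((hwi _).differentiable hne _),
        Finset.sum_add_distrib, Finset.mul_sum, mul_comm (w _ _)]
      ring
  intro t₁ t₂
  simp only [(hψs _ _ _).deriv]
  exact intervalIntegral_eq_of_conservation_law hG ((hh.comp hΨ).differentiable hne) hlaw
    (fun t => by simp [hΨdef, hγclosed]) t₁ t₂
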